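/- Let λ = sup_n m_n. For every positive integer n with ⟨n⟩ ≥ 1 and every x ∈ I_{⟨n⟩+1}(e_{⟨n⟩−1} + e_{⟨n⟩}), one has n |K_n(x)| ≥ M_{⟨n⟩}² / (2πλ). -/

import Mathlib

open MeasureTheory Filter
open scoped ENNReal NNReal Real BigOperators

noncomputable section

namespace Vilenkin

instance (k : ℕ) : MeasurableSpace (ZMod k) := ⊤

/-- The Vilenkin group: the product of the cyclic groups `ZMod (m n)`. -/
abbrev G (m : ℕ → ℕ) : Type := ∀ n : ℕ, ZMod (m n)

variable (m : ℕ → ℕ)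

/-- The generalized powers `M_0 = 1`, `M_{n+1} = m_n M_n`. -/
def Mprod : ℕ → ℕ
  | 0 => 1
  | n + 1 => m n * Mprod n

/-- The `k`-th digit of `n` in the base-`M` expansion `n = Σ_k n_k M_k`. -/
def digit (n k : ℕ) : ℕ := (n / Mprod m k) % m k

/-- `⟨n⟩`, the smallest index of a nonzero digit. -/
def lowIdx (n : ℕ) : ℕ := sInf {j | digit m n j ≠ 0}

/-- `|n|`, the largest index of a nonzero digit. -/
def highIdx (n : ℕ) : ℕ := sSup {j | digit m n j ≠ 0}

/-- Generalized Rademacher functions `r_k(x) = exp(2πi x_k / m_k)`. -/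
def rad (k : ℕ) (x : G m) : ℂ :=
  Complex.exp (2 * Real.pi * Complex.I * ((x k).val : ℂ) / (m k : ℂ))

/-- The Vilenkin system `ψ_n = ∏_k r_k^{n_k}`. -/
def psi (n : ℕ) (x : G m) : ℂ :=
  ∏ k ∈ Finset.range (n + 1), rad m k x ^ digit m n k

/-- Dirichlet kernels `D_n = Σ_{k<n} ψ_k`. -/
def Dker (n : ℕ) (x : G m) : ℂ := ∑ k ∈ Finset.range n, psi m k x

/-- Fejér kernels `K_n = (1/n) Σ_{k<n} D_k`. -/
def Kker (n : ℕ) (x : G m) : ℂ := (n : ℂ)⁻¹ * ∑ k ∈ Finset.range n, Dker m k x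

/-- The cylinder `I_n(x)`. -/
def cylinder (n : ℕ) (x : G m) : Set (G m) := {y | ∀ j, j < n → y j = x j}

/-- `e_t`: the element with `t`-th coordinate `1` and all others `0`. -/
def eVec (t : ℕ) : G m := fun j => if j = t then 1 else 0

/-- The filtration `F_n` generated by the cylinders of level `n`. -/
def filtr (n : ℕ) : MeasurableSpace (G m) :=
  MeasurableSpace.comap (fun x (j : Fin n) => x j.val) inferInstance

/-- The normalized Haar measure on `G_m`: the probability measure giving each cylinder
`I_n(x)` measure `1/M_n`. -/
def IsVilenkinMeasure (μ : Measure (G m)) : Prop :=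
  IsProbabilityMeasure μ ∧ ∀ n x, μ (cylinder m n x) = (Mprod m n : ℝ≥0∞)⁻¹

/-- Martingales with respect to the filtration `(F_n)`. -/
def IsMartingale (μ : Measure (G m)) (f : ℕ → G m → ℂ) : Prop :=
  (∀ n, Integrable (f n) μ) ∧
  (∀ n, Measurable[filtr m n] (f n)) ∧
  (∀ n, ∀ s : Set (G m), MeasurableSet[filtr m n] s →
    ∫ x in s, f (n + 1) x ∂μ = ∫ x in s, f n x ∂μ)

/-- The maximal function `f* = sup_n |f^{(n)}|` (with values in `ℝ≥0∞`). -/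
def maximalFn (f : ℕ → G m → ℂ) (x : G m) : ℝ≥0∞ := ⨆ n, (‖f n x‖₊ : ℝ≥0∞)

/-- The martingale Hardy space quasi-norm `‖f‖_{H_p} = ‖f*‖_{L_p}`. -/
def hardyNorm (p : ℝ) (μ : Measure (G m)) (f : ℕ → G m → ℂ) : ℝ≥0∞ :=
  (∫⁻ x, maximalFn m f x ^ p ∂μ) ^ (1 / p)

/-- Vilenkin-Fourier coefficients of an integrable function. -/
def fourierCoeff (μ : Measure (G m)) (g : G m → ℂ) (k : ℕ) : ℂ :=
  ∫ x, g x * (starRingEnd ℂ) (psi m k x) ∂μ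

/-- Partial sums `S_n g` of the Vilenkin-Fourier series of a function. -/
def SFun (μ : Measure (G m)) (g : G m → ℂ) (n : ℕ) (x : G m) : ℂ :=
  ∑ k ∈ Finset.range n, fourierCoeff m μ g k * psi m k x

/-- Fejér means `σ_n g` of a function. -/
def sigmaFun (μ : Measure (G m)) (g : G m → ℂ) (n : ℕ) (x : G m) : ℂ :=
  (n : ℂ)⁻¹ * ∑ k ∈ Finset.range n, SFun m μ g k x

/-- Vilenkin-Fourier coefficients of a martingale:
`f̂(i) = lim_k ∫ f^{(k)} ψ̄_i dμ`. -/
def martCoeff (μ : Measure (G m)) (f : ℕ → G m → ℂ) (i : ℕ) : ℂ :=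
  limUnder atTop fun k => ∫ x, f k x * (starRingEnd ℂ) (psi m i x) ∂μ

/-- Partial sums `S_n f` of the Vilenkin-Fourier series of a martingale. -/
def SMart (μ : Measure (G m)) (f : ℕ → G m → ℂ) (n : ℕ) (x : G m) : ℂ :=
  ∑ k ∈ Finset.range n, martCoeff m μ f k * psi m k x

/-- Fejér means `σ_n f` of a martingale. -/
def sigmaMart (μ : Measure (G m)) (f : ℕ → G m → ℂ) (n : ℕ) (x : G m) : ℂ :=
  (n : ℂ)⁻¹ * ∑ k ∈ Finset.range n, SMart m μ f k x

/-- The weak `L_p` quasi-norm `‖g‖_{L_{p,∞}} = (sup_λ λ^p μ(|g|>λ))^{1/p}`. -/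
def weakNorm (p : ℝ) (μ : Measure (G m)) (g : G m → ℂ) : ℝ≥0∞ :=
  (⨆ lam : ℝ≥0, (lam : ℝ≥0∞) ^ p * μ {x | (lam : ℝ) < ‖g x‖}) ^ (1 / p)

/-- A `p`-atom with prescribed support interval `I_N(x₀)`. -/
def IsPAtomAt (p : ℝ) (μ : Measure (G m)) (N : ℕ) (x₀ : G m) (a : G m → ℂ) : Prop :=
  Measurable a ∧ Function.support a ⊆ cylinder m N x₀ ∧
    (∫ x in cylinder m N x₀, a x ∂μ) = 0 ∧
    eLpNorm a ⊤ μ ≤ μ (cylinder m N x₀) ^ (-(1 / p))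

/-- A `p`-atom. -/
def IsPAtom (p : ℝ) (μ : Measure (G m)) (a : G m → ℂ) : Prop :=
  ∃ N x₀, IsPAtomAt m p μ N x₀ a

/-- The sets `I_N^{i,j}` for `i < j ≤ N`. -/
def IsetIJ (N i j : ℕ) : Set (G m) :=
  if j < N then
    {x | (∀ l, l < i → x l = 0) ∧ x i ≠ 0 ∧ (∀ l, i < l → l < j → x l = 0) ∧ x j ≠ 0}
  else
    {x | (∀ l, l < i → x l = 0) ∧ x i ≠ 0 ∧ (∀ l, i < l → l < N → x l = 0)}

section Digits

variable {m : ℕ → ℕ}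

lemma Mprod_pos (hm : ∀ n, 2 ≤ m n) (n : ℕ) : 0 < Mprod m n := by
  induction n with
  | zero => exact Nat.one_pos
  | succ n ih => exact Nat.mul_pos (by linarith [hm n]) ih

lemma lt_Mprod (hm : ∀ n, 2 ≤ m n) (n : ℕ) : n < Mprod m n := by
  induction n with
  | zero => exact Nat.one_pos
  | succ n ih =>
    change n + 1 < m n * Mprod m n
    nlinarith [hm n]

lemma Mprod_dvd {i j : ℕ} (h : i ≤ j) : Mprod m i ∣ Mprod m j := by
  induction j, h using Nat.le_induction with
  | base => exact dvd_rfl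
  | succ j _ ih => exact ih.mul_left _

lemma digit_eq_zero_of_lt {r j : ℕ} (h : r < Mprod m j) : digit m r j = 0 := by
  simp [digit, Nat.div_eq_of_lt h]

lemma digit_mul_add_of_lt (hm : ∀ n, 2 ≤ m n) {N j : ℕ} (h : j < N) (s r : ℕ) :
    digit m (s * Mprod m N + r) j = digit m r j := by
  obtain ⟨c, hc⟩ : Mprod m (j + 1) ∣ Mprod m N := Mprod_dvd h
  have e : s * Mprod m N + r = r + Mprod m j * (m j * (s * c)) := by
    rw [hc, Mprod]; ring
  rw [digit, digit, e, Nat.add_mul_div_left _ _ (Mprod_pos hm j), Nat.add_mul_mod_self_left]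

lemma digit_mul_add_of_le (hm : ∀ n, 2 ≤ m n) {N j : ℕ} (h : N ≤ j) (s : ℕ) {r : ℕ}
    (hr : r < Mprod m N) :
    digit m (s * Mprod m N + r) j = digit m (s * Mprod m N) j := by
  obtain ⟨c, hc⟩ : Mprod m N ∣ Mprod m j := Mprod_dvd h
  have hN := Mprod_pos hm N
  rw [digit, digit, hc, ← Nat.div_div_eq_div_mul, ← Nat.div_div_eq_div_mul,
    Nat.mul_div_cancel _ hN, mul_comm s, Nat.mul_add_div hN, Nat.div_eq_of_lt hr, add_zero]

lemma digit_mul_add (hm : ∀ n, 2 ≤ m n) (N s : ℕ) {r : ℕ} (hr : r < Mprod m N) (j : ℕ) :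
    digit m (s * Mprod m N + r) j = digit m (s * Mprod m N) j + digit m r j := by
  rcases lt_or_ge j N with h | h
  · have h0 : digit m (s * Mprod m N) j = 0 := by
      simpa [digit] using digit_mul_add_of_lt hm h s 0
    rw [digit_mul_add_of_lt hm h, h0, zero_add]
  · have hj : r < Mprod m j := hr.trans_le (Nat.le_of_dvd (Mprod_pos hm j) (Mprod_dvd h))
    rw [digit_mul_add_of_le hm h s hr, digit_eq_zero_of_lt hj, add_zero]

lemma Mprod_dvd_of_digit_eq_zero (hm : ∀ n, 2 ≤ m n) {n N : ℕ}
    (h : ∀ j < N, digit m n j = 0) : Mprod m N ∣ n := by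
  induction N with
  | zero => exact one_dvd n
  | succ N ih =>
    obtain ⟨q, hq⟩ := ih fun j hj => h j (hj.trans N.lt_succ_self)
    have h0 := h N N.lt_succ_self
    rw [digit, hq, Nat.mul_div_cancel_left _ (Mprod_pos hm N)] at h0
    rw [hq, Mprod, mul_comm (m N)]
    exact Nat.mul_dvd_mul_left _ (Nat.dvd_of_mod_eq_zero h0)

end Digits

section Characters

variable {m : ℕ → ℕ}

lemma norm_rad (k : ℕ) (x : G m) : ‖rad m k x‖ = 1 := by
  have e : rad m k x =
      Complex.exp (((2 * Real.pi * (x k).val / m k : ℝ) : ℂ) * Complex.I) := by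
    rw [rad]; congr 1; push_cast; ring
  rw [e, Complex.norm_exp_ofReal_mul_I]

lemma norm_psi (n : ℕ) (x : G m) : ‖psi m n x‖ = 1 := by
  simp [psi, norm_prod, norm_rad]

lemma psi_eq_prod_range (hm : ∀ n, 2 ≤ m n) {n L : ℕ} (h : n < L) (x : G m) :
    psi m n x = ∏ k ∈ Finset.range L, rad m k x ^ digit m n k := by
  refine Finset.prod_subset (Finset.range_subset_range.2 h) fun k _ hk => ?_
  have hk' : n < k := by simpa using hk
  rw [digit_eq_zero_of_lt (hk'.trans (lt_Mprod hm k)), pow_zero]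

lemma psi_mul_add (hm : ∀ n, 2 ≤ m n) (N s : ℕ) {r : ℕ} (hr : r < Mprod m N) (x : G m) :
    psi m (s * Mprod m N + r) x = psi m (s * Mprod m N) x * psi m r x := by
  have h₁ : s * Mprod m N < s * Mprod m N + r + 1 := by omega
  have h₂ : r < s * Mprod m N + r + 1 := by omega
  rw [psi_eq_prod_range hm h₁, psi_eq_prod_range hm h₂, psi, ← Finset.prod_mul_distrib]
  exact Finset.prod_congr rfl fun j _ => by rw [digit_mul_add hm N s hr, pow_add]

lemma psi_mul_Mprod (hm : ∀ n, 2 ≤ m n) (N : ℕ) {t : ℕ} (ht : t < m N) (x : G m) :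
    psi m (t * Mprod m N) x = rad m N x ^ t := by
  have hd : digit m (t * Mprod m N) N = t := by
    rw [digit, Nat.mul_div_cancel _ (Mprod_pos hm N), Nat.mod_eq_of_lt ht]
  have hL : t * Mprod m N < t * Mprod m N + N + 1 := by omega
  rw [psi_eq_prod_range hm hL, Finset.prod_eq_single N, hd]
  · intro j _ hj
    rcases lt_or_gt_of_ne hj with h | h
    · have h0 : digit m (t * Mprod m N) j = 0 := by
        simpa [digit] using digit_mul_add_of_lt hm h t 0
      rw [h0, pow_zero]
    · have h1 : t * Mprod m N < Mprod m j := calc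
        t * Mprod m N < Mprod m (N + 1) := Nat.mul_lt_mul_of_pos_right ht (Mprod_pos hm N)
        _ ≤ Mprod m j := Nat.le_of_dvd (Mprod_pos hm j) (Mprod_dvd h)
      rw [digit_eq_zero_of_lt h1, pow_zero]
  · intro h
    exact absurd (Finset.mem_range.2 (by omega)) h

lemma psi_eq_one (hm : ∀ n, 2 ≤ m n) {N r : ℕ} (hr : r < Mprod m N) {x : G m}
    (hx : ∀ j < N, x j = 0) : psi m r x = 1 := by
  refine Finset.prod_eq_one fun j _ => ?_
  rcases lt_or_ge j N with h | h
  · have : rad m j x = 1 := by simp [rad, hx j h]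
    rw [this, one_pow]
  · rw [digit_eq_zero_of_lt (hr.trans_le (Nat.le_of_dvd (Mprod_pos hm j) (Mprod_dvd h))),
      pow_zero]

lemma psi_succ_level (hm : ∀ n, 2 ≤ m n) (N a : ℕ) {t : ℕ} (ht : t < m N) (x : G m) :
    psi m ((a * m N + t) * Mprod m N) x = psi m (a * Mprod m (N + 1)) x * rad m N x ^ t := by
  have h : t * Mprod m N < Mprod m (N + 1) :=
    Nat.mul_lt_mul_of_pos_right ht (Mprod_pos hm N)
  rw [← psi_mul_Mprod hm N ht, ← psi_mul_add hm (N + 1) a h, Mprod]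
  congr 1; ring

end Characters

section RootOfUnity

variable {m : ℕ → ℕ}

lemma rad_eq_exp (hm : ∀ n, 2 ≤ m n) {k : ℕ} {x : G m} (hx : x k = 1) :
    rad m k x = Complex.exp (2 * Real.pi * Complex.I / (m k : ℂ)) := by
  have : Fact (1 < m k) := ⟨hm k⟩
  rw [rad, hx, ZMod.val_one]
  simp

lemma isPrimitiveRoot_rad (hm : ∀ n, 2 ≤ m n) {k : ℕ} {x : G m} (hx : x k = 1) :
    IsPrimitiveRoot (rad m k x) (m k) := by
  rw [rad_eq_exp hm hx]
  exact Complex.isPrimitiveRoot_exp _ (by linarith [hm k])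

lemma norm_rad_pow_sub_one (hm : ∀ n, 2 ≤ m n) {k : ℕ} {x : G m} (hx : x k = 1) (c : ℕ) :
    ‖rad m k x ^ c - 1‖ = 2 * |Real.sin (Real.pi * c / m k)| := by
  have e : rad m k x ^ c =
      Complex.exp (Complex.I * ((2 * (Real.pi * c / m k) : ℝ) : ℂ)) := by
    rw [rad_eq_exp hm hx, ← Complex.exp_nat_mul]; congr 1; push_cast; ring
  rw [e, Complex.norm_exp_I_mul_ofReal_sub_one, norm_mul, mul_div_cancel_left₀ _ two_ne_zero]
  simp

lemma norm_rad_sub_one_le (hm : ∀ n, 2 ≤ m n) {k : ℕ} {x : G m} (hx : x k = 1) :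
    ‖rad m k x - 1‖ ≤ 2 * Real.pi / m k := by
  have h := norm_rad_pow_sub_one hm hx 1
  rw [pow_one] at h
  have h1 := Real.abs_sin_le_abs (x := Real.pi * (1 : ℕ) / m k)
  rw [abs_of_nonneg (a := Real.pi * (1 : ℕ) / m k) (by positivity)] at h1
  rw [h]
  calc _ ≤ 2 * (Real.pi * (1 : ℕ) / m k) := by linarith
    _ = _ := by push_cast; ring

lemma sin_pi_div_le {k c : ℕ} (hc : 1 ≤ c) (hck : c < k) :
    Real.sin (Real.pi / k) ≤ Real.sin (Real.pi * c / k) := by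
  have hk : (0 : ℝ) < k := by exact_mod_cast (by omega : 0 < k)
  have hc1 : (1 : ℝ) ≤ c := by exact_mod_cast hc
  have hck1 : (c : ℝ) + 1 ≤ k := by exact_mod_cast hck
  have hpi := Real.pi_pos
  have h0 : 0 < Real.pi / k := by positivity
  rcases le_total (Real.pi * c / k) (Real.pi / 2) with h | h
  · refine Real.sin_le_sin_of_le_of_le_pi_div_two (by linarith) h ?_
    gcongr
    nlinarith
  · rw [← Real.sin_pi_sub (Real.pi * c / k)]
    refine Real.sin_le_sin_of_le_of_le_pi_div_two (by linarith) (by linarith) ?_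
    have e : Real.pi - Real.pi * c / k = Real.pi * (k - c) / k := by field_simp
    rw [e]
    gcongr
    nlinarith

lemma one_le_norm_geom_sum_rad (hm : ∀ n, 2 ≤ m n) {k : ℕ} {x : G m} (hx : x k = 1) {c : ℕ}
    (hc : 1 ≤ c) (hck : c < m k) : 1 ≤ ‖∑ t ∈ Finset.range c, rad m k x ^ t‖ := by
  have hne : rad m k x - 1 ≠ 0 :=
    sub_ne_zero.2 ((isPrimitiveRoot_rad hm hx).ne_one (hm k))
  have h := congrArg norm (mul_geom_sum (rad m k x) c)
  rw [norm_mul] at h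
  have h1 := norm_rad_pow_sub_one hm hx 1
  have h2 := norm_rad_pow_sub_one hm hx c
  have h3 : |Real.sin (Real.pi * (1 : ℕ) / m k)| ≤ |Real.sin (Real.pi * c / m k)| := by
    rw [abs_of_nonneg]
    · simpa using (sin_pi_div_le hc hck).trans (le_abs_self _)
    · have hk : (1 : ℝ) ≤ m k := by exact_mod_cast (by linarith [hm k] : 1 ≤ m k)
      refine Real.sin_nonneg_of_nonneg_of_le_pi (by positivity) ?_
      rw [Nat.cast_one, mul_one]
      exact div_le_self Real.pi_pos.le hk
  rw [pow_one] at h1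
  have hpos := norm_pos_iff.2 hne
  by_contra! hlt
  nlinarith

end RootOfUnity

section Kernels

variable {m : ℕ → ℕ}

lemma sum_range_mul_eq {E : Type*} [AddCommMonoid E] (f : ℕ → E) (q M : ℕ) :
    ∑ k ∈ Finset.range (q * M), f k =
      ∑ s ∈ Finset.range q, ∑ r ∈ Finset.range M, f (s * M + r) := by
  induction q with
  | zero => simp
  | succ q ih => rw [Nat.succ_mul, Finset.sum_range_add, ih, Finset.sum_range_succ]

lemma Dker_mul_Mprod (hm : ∀ n, 2 ≤ m n) (N s : ℕ) (x : G m) :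
    Dker m (s * Mprod m N) x =
      (∑ i ∈ Finset.range s, psi m (i * Mprod m N) x) * Dker m (Mprod m N) x := by
  rw [Dker, sum_range_mul_eq, Finset.sum_mul]
  refine Finset.sum_congr rfl fun i _ => ?_
  rw [Dker, Finset.mul_sum]
  exact Finset.sum_congr rfl fun r hr => psi_mul_add hm N i (Finset.mem_range.1 hr) x

lemma Dker_mul_add (hm : ∀ n, 2 ≤ m n) (N s : ℕ) {r : ℕ} (hr : r ≤ Mprod m N) (x : G m) :
    Dker m (s * Mprod m N + r) x =
      Dker m (s * Mprod m N) x + psi m (s * Mprod m N) x * Dker m r x := by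
  rw [Dker, Finset.sum_range_add, Dker, Dker, Finset.mul_sum]
  congr 1
  exact Finset.sum_congr rfl fun i hi =>
    psi_mul_add hm N s ((Finset.mem_range.1 hi).trans_le hr) x

lemma Dker_eq_natCast (hm : ∀ n, 2 ≤ m n) {N r : ℕ} (hr : r ≤ Mprod m N) {x : G m}
    (hx : ∀ j < N, x j = 0) : Dker m r x = r := by
  rw [Dker, Finset.sum_congr rfl fun i hi =>
    psi_eq_one hm ((Finset.mem_range.1 hi).trans_le hr) hx]
  simp

lemma Dker_mul_add_of_zero (hm : ∀ n, 2 ≤ m n) {N t u : ℕ} (ht : t < m N)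
    (hu : u ≤ Mprod m N) {x : G m} (hx : ∀ j < N, x j = 0) :
    Dker m (t * Mprod m N + u) x =
      (∑ i ∈ Finset.range t, rad m N x ^ i) * Mprod m N + rad m N x ^ t * u := by
  rw [Dker_mul_add hm N t hu, Dker_mul_Mprod hm, Dker_eq_natCast hm le_rfl hx,
    Dker_eq_natCast hm hu hx, psi_mul_Mprod hm N ht]
  congr 2
  exact Finset.sum_congr rfl fun i hi =>
    psi_mul_Mprod hm N ((Finset.mem_range.1 hi).trans ht) x

lemma geom_sum_rad_eq_zero (hm : ∀ n, 2 ≤ m n) {N : ℕ} {x : G m} (hx : x N = 1) :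
    ∑ t ∈ Finset.range (m N), rad m N x ^ t = 0 :=
  (isPrimitiveRoot_rad hm hx).geom_sum_eq_zero (hm N)

lemma Dker_Mprod_succ_eq_zero (hm : ∀ n, 2 ≤ m n) {N : ℕ} {x : G m} (hx : x N = 1) :
    Dker m (Mprod m (N + 1)) x = 0 := by
  rw [Mprod, Dker_mul_Mprod hm, Finset.sum_congr rfl fun i hi =>
    psi_mul_Mprod hm N (Finset.mem_range.1 hi) x, geom_sum_rad_eq_zero hm hx, zero_mul]

lemma sum_Dker_Mprod_succ (hm : ∀ n, 2 ≤ m n) {N : ℕ} {x : G m} (hx : ∀ j < N, x j = 0)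
    (hxN : x N = 1) :
    (rad m N x - 1) * ∑ k ∈ Finset.range (Mprod m (N + 1)), Dker m k x =
      -((m N : ℂ) * (Mprod m N : ℂ) ^ 2) := by
  have h : ∀ t ∈ Finset.range (m N),
      (rad m N x - 1) * ∑ u ∈ Finset.range (Mprod m N), Dker m (t * Mprod m N + u) x =
        rad m N x ^ t * ((Mprod m N : ℂ) ^ 2 +
          (rad m N x - 1) * ∑ u ∈ Finset.range (Mprod m N), (u : ℂ)) -
          (Mprod m N : ℂ) ^ 2 := by
    intro t ht
    rw [Finset.sum_congr rfl fun u hu => Dker_mul_add_of_zero hm (Finset.mem_range.1 ht)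
      (Finset.mem_range.1 hu).le hx, Finset.sum_add_distrib]
    simp only [Finset.sum_const, Finset.card_range, nsmul_eq_mul, ← Finset.mul_sum]
    linear_combination (Mprod m N : ℂ) ^ 2 * mul_geom_sum (rad m N x) t
  rw [Mprod, sum_range_mul_eq, Finset.mul_sum, Finset.sum_congr rfl h,
    Finset.sum_sub_distrib, ← Finset.sum_mul, geom_sum_rad_eq_zero hm hxN]
  simp

lemma le_norm_sum_Dker_Mprod_succ (hm : ∀ n, 2 ≤ m n) {N : ℕ} {x : G m}
    (hx : ∀ j < N, x j = 0) (hxN : x N = 1) :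
    (Mprod m (N + 1) : ℝ) ^ 2 / (2 * Real.pi) ≤
      ‖∑ k ∈ Finset.range (Mprod m (N + 1)), Dker m k x‖ := by
  have h := congrArg norm (sum_Dker_Mprod_succ hm hx hxN)
  rw [norm_mul, norm_neg, norm_mul, norm_pow, Complex.norm_natCast, Complex.norm_natCast] at h
  have hmN : (0 : ℝ) < m N := by exact_mod_cast (by linarith [hm N] : 0 < m N)
  have h1 := mul_le_mul_of_nonneg_right (norm_rad_sub_one_le hm hxN)
    (norm_nonneg (∑ k ∈ Finset.range (Mprod m (N + 1)), Dker m k x))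
  rw [h, div_mul_eq_mul_div, le_div_iff₀ hmN] at h1
  rw [div_le_iff₀ (by positivity), Mprod, Nat.cast_mul]
  rw [Mprod] at h1
  linarith

lemma sum_Dker_mul_Mprod (hm : ∀ n, 2 ≤ m n) {N : ℕ} {x : G m}
    (hD : Dker m (Mprod m N) x = 0) (q : ℕ) :
    ∑ k ∈ Finset.range (q * Mprod m N), Dker m k x =
      (∑ s ∈ Finset.range q, psi m (s * Mprod m N) x) *
        ∑ k ∈ Finset.range (Mprod m N), Dker m k x := by
  rw [sum_range_mul_eq, Finset.sum_mul]
  refine Finset.sum_congr rfl fun s _ => ?_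
  rw [Finset.mul_sum]
  refine Finset.sum_congr rfl fun r hr => ?_
  rw [Dker_mul_add hm N s (Finset.mem_range.1 hr).le, Dker_mul_Mprod hm, hD, mul_zero, zero_add]

lemma sum_psi_mul_Mprod (hm : ∀ n, 2 ≤ m n) {N : ℕ} {x : G m} (hx : x N = 1) (a : ℕ) {c : ℕ}
    (hc : c < m N) :
    ∑ s ∈ Finset.range (a * m N + c), psi m (s * Mprod m N) x =
      psi m (a * Mprod m (N + 1)) x * ∑ t ∈ Finset.range c, rad m N x ^ t := by
  rw [Finset.sum_range_add, sum_range_mul_eq, Finset.mul_sum, Finset.sum_eq_zero, zero_add]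
  · exact Finset.sum_congr rfl fun t ht =>
      psi_succ_level hm N a ((Finset.mem_range.1 ht).trans hc) x
  · intro i _
    rw [Finset.sum_congr rfl fun t ht => psi_succ_level hm N i (Finset.mem_range.1 ht) x,
      ← Finset.mul_sum, geom_sum_rad_eq_zero hm hx, mul_zero]

lemma one_le_norm_sum_psi (hm : ∀ n, 2 ≤ m n) {N : ℕ} {x : G m} (hx : x N = 1) {q : ℕ}
    (hq : q % m N ≠ 0) : 1 ≤ ‖∑ s ∈ Finset.range q, psi m (s * Mprod m N) x‖ := by
  have hlt : q % m N < m N := Nat.mod_lt _ (by linarith [hm N])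
  have h := sum_psi_mul_Mprod hm hx (q / m N) hlt
  rw [Nat.div_add_mod'] at h
  rw [h, norm_mul, norm_psi, one_mul]
  exact one_le_norm_geom_sum_rad hm hx (Nat.one_le_iff_ne_zero.2 hq) hlt

end Kernels

/-- Lemma 5, second part: with `λ = sup_n m_n`, for `⟨n⟩ ≥ 1` and
`x ∈ I_{⟨n⟩+1}(e_{⟨n⟩-1} + e_{⟨n⟩})` one has `n|K_n(x)| ≥ M_{⟨n⟩}²/(2πλ)`. -/
theorem fejer_kernel_lower_bound
    (m : ℕ → ℕ) (hm : ∀ n, 2 ≤ m n) (hbdd : ∃ B, ∀ n, m n ≤ B) :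
    ∀ n : ℕ, 0 < n → 1 ≤ lowIdx m n →
      ∀ x ∈ cylinder m (lowIdx m n + 1) (eVec m (lowIdx m n - 1) + eVec m (lowIdx m n)),
        (Mprod m (lowIdx m n) : ℝ) ^ 2 / (2 * Real.pi * ((⨆ k, m k : ℕ) : ℝ)) ≤
          (n : ℝ) * ‖Kker m n x‖ := by
  intro n hn hlow x hx
  have hne : {j | digit m n j ≠ 0}.Nonempty := by
    by_contra h
    rw [lowIdx, Set.not_nonempty_iff_eq_empty.1 h, Nat.sInf_empty] at hlow
    omega
  have hdig : digit m n (lowIdx m n) ≠ 0 := Nat.sInf_mem hne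
  have hzero : ∀ j < lowIdx m n, digit m n j = 0 := fun j hj =>
    not_not.1 (Nat.notMem_of_lt_sInf hj)
  generalize lowIdx m n = L at *
  obtain ⟨N, rfl⟩ : ∃ N, L = N + 1 := ⟨L - 1, by omega⟩
  obtain ⟨q, rfl⟩ := Mprod_dvd_of_digit_eq_zero hm hzero
  rw [digit, Nat.mul_div_cancel_left _ (Mprod_pos hm _)] at hdig
  have hx0 : ∀ j < N, x j = 0 := fun j hj => by
    rw [hx j (by omega)]
    have hj' : j ≠ N + 1 := by omega
    simp [eVec, hj.ne, hj']
  have hx1 : x N = 1 := by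
    rw [hx N (by omega)]
    simp [eVec]
  have hx2 : x (N + 1) = 1 := by
    rw [hx (N + 1) (by omega)]
    simp [eVec]
  have hsup : 1 ≤ ⨆ k, m k := by
    obtain ⟨B, hB⟩ := hbdd
    have h0 := le_ciSup (f := m) ⟨B, by rintro _ ⟨k, rfl⟩; exact hB k⟩ 0
    linarith [hm 0]
  have hsup' : (1 : ℝ) ≤ ((⨆ k, m k : ℕ) : ℝ) := by exact_mod_cast hsup
  have hn' : ((Mprod m (N + 1) * q : ℕ) : ℝ) ≠ 0 := by exact_mod_cast hn.ne'
  have hK : ((Mprod m (N + 1) * q : ℕ) : ℝ) * ‖Kker m (Mprod m (N + 1) * q) x‖ =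
      ‖∑ k ∈ Finset.range (q * Mprod m (N + 1)), Dker m k x‖ := by
    rw [Kker, norm_mul, norm_inv, Complex.norm_natCast, mul_inv_cancel_left₀ hn', mul_comm q]
  rw [hK, sum_Dker_mul_Mprod hm (Dker_Mprod_succ_eq_zero hm hx1), norm_mul]
  calc (Mprod m (N + 1) : ℝ) ^ 2 / (2 * Real.pi * ((⨆ k, m k : ℕ) : ℝ))
      ≤ (Mprod m (N + 1) : ℝ) ^ 2 / (2 * Real.pi) := by
        exact div_le_div_of_nonneg_left (by positivity) (by positivity)
          (le_mul_of_one_le_right (by positivity) hsup')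
    _ ≤ ‖∑ k ∈ Finset.range (Mprod m (N + 1)), Dker m k x‖ :=
        le_norm_sum_Dker_Mprod_succ hm hx0 hx1
    _ ≤ _ := le_mul_of_one_le_left (norm_nonneg _) (one_le_norm_sum_psi hm hx2 hdig)

end Vilenkin
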